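/- arXiv:1307.0186 — 6 statements merged into one kernel-verified Lean document; each statement's English description precedes it below -/
import Mathlib

section
/- Let H and K be complex Hilbert spaces, let D be a linear subspace of H and let w : D → K be a linear map. Let Z : K → K be a bounded self-adjoint operator, let R, S : H → K be bounded linear operators and let C : H → H be a bounded linear operator. Define the sesquilinear form a on D by a(u,v) = ⟨(I + iZ)(w u), w v⟩_K + ⟨w u, R v⟩_K + ⟨S u, w v⟩_K + ⟨C u, v⟩_H. Then a is sectorial: there exist γ ∈ ℝ and c ≥ 0 such that for all u ∈ D one has Re a(u,u) − γ‖u‖_H² ≥ 0 and |Im a(u,u)| ≤ c (Re a(u,u) − γ‖u‖_H²). -/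
open scoped ComplexInnerProductSpace

/-- A sesquilinear form of the shape
`a(u,v) = ⟨(I+iZ)(w u), w v⟩_K + ⟨w u, R v⟩_K + ⟨S u, w v⟩_K + ⟨C u, v⟩_H`
(inner products linear in the first argument, i.e. `⟨x,y⟩_paper = ⟪y,x⟫_Mathlib`) with `Z`
bounded self-adjoint and `R`, `S`, `C` bounded is sectorial. -/
theorem stmt3 {H K : Type*}
    [NormedAddCommGroup H] [InnerProductSpace ℂ H] [CompleteSpace H]
    [NormedAddCommGroup K] [InnerProductSpace ℂ K] [CompleteSpace K]
    (D : Submodule ℂ H) (w : D →ₗ[ℂ] K)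
    (Z : K →L[ℂ] K) (hZ : IsSelfAdjoint Z)
    (R S : H →L[ℂ] K) (C : H →L[ℂ] H)
    (a : D → D → ℂ)
    (ha : ∀ u v : D,
      a u v = ⟪w v, w u + Complex.I • Z (w u)⟫ + ⟪R v, w u⟫ + ⟪w v, S u⟫ + ⟪(v : H), C u⟫) :
    ∃ (γ : ℝ) (c : ℝ), 0 ≤ c ∧ ∀ u : D,
      0 ≤ (a u u).re - γ * ‖(u : H)‖ ^ 2 ∧
      |(a u u).im| ≤ c * ((a u u).re - γ * ‖(u : H)‖ ^ 2) := by
  refine ⟨-((‖R‖ + ‖S‖) ^ 2 + 2 * ‖C‖), 2 * ‖Z‖ + 1, by positivity, fun u => ?_⟩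
  set E : ℂ := ⟪R u, w u⟫ + ⟪w u, S u⟫ + ⟪(u : H), C u⟫ with hE
  set q : ℂ := ⟪w u, Z (w u)⟫ with hq
  have hqim : q.im = 0 := by
    have h1 : ⟪Z (w u), w u⟫ = ⟪w u, Z (w u)⟫ := hZ.isSymmetric (w u) (w u)
    have h2 : (starRingEnd ℂ) q = q := by
      rw [hq, inner_conj_symm]; exact h1
    exact Complex.conj_eq_iff_im.mp h2
  have hx : (⟪w u, w u⟫ : ℂ) = ((‖w u‖ ^ 2 : ℝ) : ℂ) := by
    rw [inner_self_eq_norm_sq_to_K]; norm_cast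
  have haE : a u u = ((‖w u‖ ^ 2 : ℝ) : ℂ) + Complex.I * q + E := by
    rw [ha, inner_add_right, inner_smul_right, hx, hE, hq]; ring
  have hre : (a u u).re = ‖w u‖ ^ 2 + E.re := by
    rw [haE, Complex.add_re, Complex.add_re, Complex.ofReal_re, Complex.I_mul_re, hqim]; ring
  have him : (a u u).im = q.re + E.im := by
    rw [haE, Complex.add_im, Complex.add_im, Complex.ofReal_im, Complex.I_mul_im]; ring
  have hqn : |q.re| ≤ ‖Z‖ * ‖w u‖ ^ 2 := by
    refine (Complex.abs_re_le_norm q).trans ((norm_inner_le_norm _ _).trans ?_)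
    calc ‖w u‖ * ‖Z (w u)‖ ≤ ‖w u‖ * (‖Z‖ * ‖w u‖) := by gcongr; exact Z.le_opNorm _
      _ = _ := by ring
  have hEn : ‖E‖ ≤ (‖R‖ + ‖S‖) * ‖w u‖ * ‖(u : H)‖ + ‖C‖ * ‖(u : H)‖ ^ 2 := by
    have h1 : ‖(⟪R u, w u⟫ : ℂ)‖ ≤ (‖R‖ * ‖(u : H)‖) * ‖w u‖ :=
      (norm_inner_le_norm _ _).trans (by gcongr; exact R.le_opNorm _)
    have h2 : ‖(⟪w u, S u⟫ : ℂ)‖ ≤ ‖w u‖ * (‖S‖ * ‖(u : H)‖) :=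
      (norm_inner_le_norm _ _).trans (by gcongr; exact S.le_opNorm _)
    have h3 : ‖(⟪(u : H), C u⟫ : ℂ)‖ ≤ ‖(u : H)‖ * (‖C‖ * ‖(u : H)‖) :=
      (norm_inner_le_norm _ _).trans (by gcongr; exact C.le_opNorm _)
    have h4 : ‖E‖ ≤ _ := norm_add₃_le
    linarith
  have hr := abs_le.mp ((Complex.abs_re_le_norm E).trans hEn)
  have hi := (Complex.abs_im_le_norm E).trans hEn
  have hZ0 := norm_nonneg Z
  have hC0 := norm_nonneg C
  rw [hre, him]
  have hsum := abs_add_le q.re E.im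
  generalize ‖R‖ + ‖S‖ = M at *
  generalize ‖w u‖ = x at *
  generalize ‖(u : H)‖ = y at *
  have hM : M * x * y ≤ x ^ 2 / 2 + M ^ 2 * y ^ 2 / 2 := by
    nlinarith [sq_nonneg (x - M * y)]
  have hP : 0 ≤ (M ^ 2 / 2 + ‖C‖) * y ^ 2 := by positivity
  have hL : x ^ 2 / 2 + (M ^ 2 / 2 + ‖C‖) * y ^ 2
      ≤ x ^ 2 + E.re - -(M ^ 2 + 2 * ‖C‖) * y ^ 2 := by
    linarith [hr.1]
  refine ⟨le_trans (by positivity) hL, ?_⟩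
  refine le_trans ?_ (mul_le_mul_of_nonneg_left hL (by positivity))
  have hQ := mul_nonneg hZ0 hP
  linarith
end

section
/- Let E be a complex Hilbert space, let Q : E → E be a bounded orthogonal projection (Q self-adjoint with Q∘Q = Q) and let Z : E → E be a bounded self-adjoint operator. Assume that I + iQZQ is invertible in the algebra of bounded operators on E, and set W := Q(I + iQZQ)^{-1}Q and P := I − Q. Then Q(I + iZ)(I − iWZ)P = 0. -/
/-- If `Q` is an orthogonal projection and `Z` a bounded self-adjoint operator on a complex
Hilbert space `E` such that `I + iQZQ` is invertible, `W := Q (I + iQZQ)⁻¹ Q` and `P := I − Q`,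
then `Q(I + iZ)(I − iWZ)P = 0`. -/
theorem stmt6 {E : Type*} [NormedAddCommGroup E] [InnerProductSpace ℂ E] [CompleteSpace E]
    (Q Z : E →L[ℂ] E) (hQsa : IsSelfAdjoint Q) (hQproj : Q * Q = Q)
    (hZ : IsSelfAdjoint Z)
    (hinv : IsUnit (1 + Complex.I • (Q * Z * Q)))
    (W : E →L[ℂ] E) (hW : W = Q * Ring.inverse (1 + Complex.I • (Q * Z * Q)) * Q)
    (P : E →L[ℂ] E) (hP : P = 1 - Q) :
    Q * (1 + Complex.I • Z) * (1 - Complex.I • (W * Z)) * P = 0 := by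
  have hR := Ring.mul_inverse_cancel _ hinv
  have h1 : Q * (1 + Complex.I • Z) * Q = Q * (1 + Complex.I • (Q * Z * Q)) := by
    simp only [mul_add, add_mul, mul_one, mul_smul_comm, smul_mul_assoc, ← mul_assoc, hQproj]
  have h2 : Q * (1 + Complex.I • Z) * W = Q := by
    calc Q * (1 + Complex.I • Z) * W
        = (Q * (1 + Complex.I • Z) * Q) *
            Ring.inverse (1 + Complex.I • (Q * Z * Q)) * Q := by
          rw [hW]; simp only [mul_assoc]
      _ = Q := by rw [h1, mul_assoc Q, hR, mul_one, hQproj]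
  have h3 : Q * P = 0 := by rw [hP, mul_sub, mul_one, hQproj, sub_self]
  have h4 : Q * (1 + Complex.I • Z) * (1 - Complex.I • (W * Z)) = Q := by
    rw [mul_sub, mul_one, mul_smul_comm, ← mul_assoc, h2, mul_add, mul_one, mul_smul_comm,
      add_sub_cancel_right]
  rw [h4, h3]
end

section
/- Let E be a complex Hilbert space, let Q : E → E be a bounded orthogonal projection (Q self-adjoint with Q∘Q = Q) and let Z : E → E be a bounded self-adjoint operator. Assume that I + iQZQ is invertible in the algebra of bounded operators on E, and set W := Q(I + iQZQ)^{-1}Q and P := I − Q. Then P(I + iZW*)(I + iZ)(I − iWZ)P = P(I + iZ + ZWZ)P, where W* denotes the adjoint of W. -/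
/-- If `Q` is an orthogonal projection and `Z` a bounded self-adjoint operator on a complex
Hilbert space `E` such that `I + iQZQ` is invertible, `W := Q (I + iQZQ)⁻¹ Q` and `P := I − Q`,
then `P(I + iZW*)(I + iZ)(I − iWZ)P = P(I + iZ + ZWZ)P`. -/
theorem stmt7 {E : Type*} [NormedAddCommGroup E] [InnerProductSpace ℂ E] [CompleteSpace E]
    (Q Z : E →L[ℂ] E) (hQsa : IsSelfAdjoint Q) (hQproj : Q * Q = Q)
    (hZ : IsSelfAdjoint Z)
    (hinv : IsUnit (1 + Complex.I • (Q * Z * Q)))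
    (W : E →L[ℂ] E) (hW : W = Q * Ring.inverse (1 + Complex.I • (Q * Z * Q)) * Q)
    (P : E →L[ℂ] E) (hP : P = 1 - Q) :
    P * (1 + Complex.I • (Z * star W)) * (1 + Complex.I • Z) * (1 - Complex.I • (W * Z)) * P
      = P * (1 + Complex.I • Z + Z * W * Z) * P := by
  have hR := Ring.mul_inverse_cancel _ hinv
  set R := Ring.inverse (1 + Complex.I • (Q * Z * Q)) with hRdef
  have hQW : Q * W = W := by
    rw [hW, ← mul_assoc, ← mul_assoc, hQproj]
  have hVQ : star W * Q = star W := by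
    have h := congrArg star hQW
    rwa [star_mul, hQsa.star_eq] at h
  have hPW : P * W = 0 := by rw [hP, sub_mul, one_mul, hQW, sub_self]
  have hQP : Q * P = 0 := by rw [hP, mul_sub, mul_one, hQproj, sub_self]
  have hVP : star W * P = 0 := by rw [← hVQ, mul_assoc, hQP, mul_zero]
  have key : W + Complex.I • (Q * Z * W) = Q := by
    have h := congrArg (fun T => Q * T * Q) hR
    simp only [add_mul, mul_add, one_mul, mul_one, smul_mul_assoc, mul_smul_comm, hQproj] at h
    rw [hW]
    calc _ = Q * R * Q + Complex.I • (Q * Q * Z * Q * R * Q) := by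
            rw [hQproj]; simp only [mul_assoc]
      _ = Q := by
            refine Eq.trans ?_ h; simp only [mul_assoc]
  have key2 : star W * (1 + Complex.I • Z) * W = star W := by
    calc _ = star W * Q * (1 + Complex.I • Z) * W := by rw [hVQ]
      _ = star W * (Q * W + Complex.I • (Q * Z * W)) := by
            simp only [add_mul, mul_add, mul_one, smul_mul_assoc, mul_smul_comm, mul_assoc]
      _ = star W := by rw [hQW, key, hVQ]
  have h1 : star W * ((1 + Complex.I • Z) * (1 - Complex.I • (W * Z)) * P) = 0 := by
    calc _ = star W * P + Complex.I • (star W * Z * P)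
          - Complex.I • ((star W * (1 + Complex.I • Z) * W) * Z * P) := by
            simp only [add_mul, mul_add, sub_mul, mul_sub, one_mul, mul_one, smul_mul_assoc,
              mul_smul_comm, mul_assoc, smul_add, smul_sub]
      _ = 0 := by rw [key2, hVP]; simp
  have h2 : (1 + Complex.I • Z) * (1 - Complex.I • (W * Z))
      = 1 + Complex.I • Z + Z * W * Z - Complex.I • (W * Z) := by
    simp only [add_mul, mul_sub, one_mul, mul_one, smul_mul_assoc,
      mul_smul_comm, mul_assoc, smul_add, smul_smul, Complex.I_mul_I, neg_smul, one_smul]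
    abel
  calc _ = P * ((1 + Complex.I • Z) * (1 - Complex.I • (W * Z))) * P
        + Complex.I • (P * Z * (star W * ((1 + Complex.I • Z) * (1 - Complex.I • (W * Z)) * P))) := by
          generalize 1 + Complex.I • Z = A
          generalize 1 - Complex.I • (W * Z) = B
          simp only [add_mul, mul_add, mul_one, smul_mul_assoc, mul_smul_comm, mul_assoc]
    _ = P * (1 + Complex.I • Z + Z * W * Z) * P - Complex.I • (P * W * Z * P) := by
          rw [h1, h2, mul_sub, sub_mul]
          simp only [mul_zero, smul_zero, add_zero, smul_mul_assoc, mul_smul_comm, mul_assoc]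
    _ = _ := by rw [hPW]; simp
end

section
/- Let E be a complex Hilbert space, let Q : E → E be a bounded orthogonal projection (Q self-adjoint with Q∘Q = Q) and let Z : E → E be a bounded self-adjoint operator. Assume that I + iQZQ is invertible in the algebra of bounded operators on E and set W := Q(I + iQZQ)^{-1}Q. Then 2 W* W = W* + W, where W* denotes the adjoint of W. -/
/-- If `Q` is an orthogonal projection and `Z` a bounded self-adjoint operator on a complex
Hilbert space `E` such that `I + iQZQ` is invertible and `W := Q (I + iQZQ)⁻¹ Q`, then
`2 W* W = W* + W`. -/
theorem stmt8 {E : Type*} [NormedAddCommGroup E] [InnerProductSpace ℂ E] [CompleteSpace E]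
    (Q Z : E →L[ℂ] E) (hQsa : IsSelfAdjoint Q) (hQproj : Q * Q = Q)
    (hZ : IsSelfAdjoint Z)
    (hinv : IsUnit (1 + Complex.I • (Q * Z * Q)))
    (W : E →L[ℂ] E) (hW : W = Q * Ring.inverse (1 + Complex.I • (Q * Z * Q)) * Q) :
    2 • (star W * W) = star W + W := by
  have hS : star (Q * Z * Q) = Q * Z * Q := by
    simp [star_mul, hQsa.star_eq, hZ.star_eq, mul_assoc]
  obtain ⟨A, hA⟩ := hinv
  have hcomm : Q * (A : E →L[ℂ] E) = A * Q := by
    rw [hA, mul_add, add_mul, mul_smul_comm, smul_mul_assoc, mul_one, one_mul]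
    congr 2
    calc Q * (Q * Z * Q) = (Q * Q) * Z * Q := by simp only [mul_assoc]
      _ = Q * Z * (Q * Q) := by simp only [hQproj]
      _ = Q * Z * Q * Q := by simp only [mul_assoc]
  have hsum : (A : E →L[ℂ] E) + star (A : E →L[ℂ] E) = 2 • (1 : E →L[ℂ] E) := by
    rw [hA, star_add, star_smul, hS, star_one]
    simp only [Complex.star_def, Complex.conj_I, neg_smul]
    abel
  rw [← hA, Ring.inverse_unit] at hW
  generalize hB : ((A⁻¹ : (E →L[ℂ] E)ˣ) : E →L[ℂ] E) = B at hW
  have hAB : (A : E →L[ℂ] E) * B = 1 := by rw [← hB]; exact A.mul_inv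
  have hBA : B * (A : E →L[ℂ] E) = 1 := by rw [← hB]; exact A.inv_mul
  have hBA' : star B * star (A : E →L[ℂ] E) = 1 := by rw [← star_mul, hAB, star_one]
  have hBQ : Q * B = B * Q := by
    calc Q * B = B * A * (Q * B) := by rw [hBA, one_mul]
      _ = B * (A * Q) * B := by simp only [mul_assoc]
      _ = B * Q * (A * B) := by rw [← hcomm]; simp only [mul_assoc]
      _ = B * Q := by rw [hAB, mul_one]
  have key : 2 • (star B * B) = star B + B := by
    calc 2 • (star B * B) = star B * (2 • (1 : E →L[ℂ] E)) * B := by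
          rw [mul_smul_comm, mul_one, smul_mul_assoc]
      _ = star B * (A * B) + star B * star (A : E →L[ℂ] E) * B := by
          rw [← hsum, mul_add, add_mul, mul_assoc]
      _ = star B + B := by rw [hAB, hBA', mul_one, one_mul]
  have hWs : star W = Q * star B * Q := by
    simp [hW, star_mul, hQsa.star_eq, mul_assoc]
  have hW2 : W = B * Q := by rw [hW, hBQ, mul_assoc, hQproj]
  have hWW : star W * W = Q * (star B * B) * Q := by
    calc star W * W = Q * star B * (Q * (Q * B * Q)) := by rw [hWs, hW]; simp only [mul_assoc]
      _ = Q * star B * (Q * B * Q) := by rw [← mul_assoc Q, ← mul_assoc Q, hQproj]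
      _ = Q * star B * (B * Q) := by rw [← hW, hW2]
      _ = _ := by simp only [mul_assoc]
  rw [hWW, ← smul_mul_assoc, ← mul_smul_comm, key, mul_add, add_mul, hWs, hW]
end

section
/- Let E be a complex Hilbert space, let Q : E → E be a bounded orthogonal projection (Q self-adjoint with Q∘Q = Q) and let Z : E → E be a bounded self-adjoint operator. Assume that I + iQZQ is invertible in the algebra of bounded operators on E, and set W := Q(I + iQZQ)^{-1}Q and P := I − Q. Then −W*(I − iZ)(I − iWZ)P + (I − iWZ)P = (I + iW*Z)P, where W* denotes the adjoint of W. -/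
/-- If `Q` is an orthogonal projection and `Z` a bounded self-adjoint operator on a complex
Hilbert space `E` such that `I + iQZQ` is invertible, `W := Q (I + iQZQ)⁻¹ Q` and `P := I − Q`,
then `−W*(I − iZ)(I − iWZ)P + (I − iWZ)P = (I + iW*Z)P`. -/
theorem stmt9 {E : Type*} [NormedAddCommGroup E] [InnerProductSpace ℂ E] [CompleteSpace E]
    (Q Z : E →L[ℂ] E) (hQsa : IsSelfAdjoint Q) (hQproj : Q * Q = Q)
    (hZ : IsSelfAdjoint Z)
    (hinv : IsUnit (1 + Complex.I • (Q * Z * Q)))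
    (W : E →L[ℂ] E) (hW : W = Q * Ring.inverse (1 + Complex.I • (Q * Z * Q)) * Q)
    (P : E →L[ℂ] E) (hP : P = 1 - Q) :
    -(star W * (1 - Complex.I • Z) * (1 - Complex.I • (W * Z)) * P)
        + (1 - Complex.I • (W * Z)) * P
      = (1 + Complex.I • (star W * Z)) * P := by
  have hQs : star Q = Q := hQsa
  have hZs : star Z = Z := hZ
  set R := Ring.inverse (1 + Complex.I • (Q * Z * Q)) with hR
  have h1 : (1 + Complex.I • (Q * Z * Q)) * R = 1 := Ring.mul_inverse_cancel _ hinv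
  have h2 : star R * (1 - Complex.I • (Q * Z * Q)) = 1 := by
    have h := congrArg star h1
    simp only [star_mul, star_add, star_one, star_smul, hQs, hZs] at h
    refine Eq.trans ?_ h
    simp [sub_eq_add_neg, mul_assoc]
  have hWs : star W = Q * star R * Q := by
    rw [hW]; simp only [star_mul, hQs, mul_assoc]
  have h3 : Q * (1 - Complex.I • Z) * Q = (1 - Complex.I • (Q * Z * Q)) * Q := by
    simp only [mul_sub, sub_mul, mul_one, one_mul, mul_smul_comm, smul_mul_assoc, hQproj, mul_assoc]
  have h4 : star W * (1 - Complex.I • Z) * W = W := by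
    calc star W * (1 - Complex.I • Z) * W
        = Q * star R * (Q * (1 - Complex.I • Z) * Q) * R * Q := by
          rw [hWs, hW]; simp only [mul_assoc]
      _ = Q * (star R * (1 - Complex.I • (Q * Z * Q))) * Q * R * Q := by
          rw [h3]; simp only [mul_assoc]
      _ = W := by rw [h2, mul_one, hQproj, hW]
  have h5 : star W * P = 0 := by
    rw [hWs, hP, mul_sub, mul_one, mul_assoc _ Q Q, hQproj, sub_self]
  have h6 : star W * (1 - Complex.I • Z) * (1 - Complex.I • (W * Z)) * P
      = star W * P - Complex.I • (star W * Z * P)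
        - Complex.I • (star W * (1 - Complex.I • Z) * W * Z * P) := by
    simp only [mul_sub, sub_mul, mul_one, one_mul, mul_smul_comm, smul_mul_assoc, mul_assoc]
  rw [h6, h4, h5]
  simp only [sub_mul, add_mul, one_mul, smul_mul_assoc]
  abel
end

section
/- Let H₁ and H₂ be complex Hilbert spaces, let B : H₁ → H₂ be a bounded linear operator and let M : H₁ → H₁ be a bounded self-adjoint operator. Assume there exists c > 0 such that ⟨M u, u⟩ ≥ ‖B u‖² + c ‖u‖² for all u ∈ H₁. Then the Hermitian sesquilinear form ⟪(u₁,w₁),(u₂,w₂)⟫ = ⟨w₁,w₂⟩ + ⟨w₁,B u₂⟩ + ⟨B u₁,w₂⟩ + ⟨M u₁,u₂⟩ is an inner product on H₁ × H₂, and its norm is equivalent to the product Hilbert space norm: there exist constants 0 < m ≤ M' such that m(‖u‖² + ‖w‖²) ≤ ⟪(u,w),(u,w)⟫ ≤ M'(‖u‖² + ‖w‖²) for all (u,w) ∈ H₁ × H₂. -/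
open scoped ComplexInnerProductSpace

/-- Let `B : H₁ → H₂` be bounded and `M : H₁ → H₁` bounded self-adjoint with
`⟨Mu,u⟩ ≥ ‖Bu‖² + c‖u‖²` for some `c > 0`. Then the Hermitian sesquilinear form
`⟪(u₁,w₁),(u₂,w₂)⟫ = ⟨w₁,w₂⟩ + ⟨w₁,Bu₂⟩ + ⟨Bu₁,w₂⟩ + ⟨Mu₁,u₂⟩` (inner products linear in the
first argument, i.e. `⟨x,y⟩_paper = ⟪y,x⟫_Mathlib`) is an inner product on `H₁ × H₂` whose norm
is equivalent to the product Hilbert space norm. -/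
theorem stmt14 {H₁ H₂ : Type*}
    [NormedAddCommGroup H₁] [InnerProductSpace ℂ H₁] [CompleteSpace H₁]
    [NormedAddCommGroup H₂] [InnerProductSpace ℂ H₂] [CompleteSpace H₂]
    (B : H₁ →L[ℂ] H₂) (M : H₁ →L[ℂ] H₁) (hM : IsSelfAdjoint M)
    (c : ℝ) (hc : 0 < c)
    (hcoerc : ∀ u : H₁, ‖B u‖ ^ 2 + c * ‖u‖ ^ 2 ≤ (⟪u, M u⟫).re)
    (β : (H₁ × H₂) → (H₁ × H₂) → ℂ)
    (hβ : ∀ p q : H₁ × H₂,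
      β p q = ⟪q.2, p.2⟫ + ⟪B q.1, p.2⟫ + ⟪q.2, B p.1⟫ + ⟪q.1, M p.1⟫) :
    (∀ p : H₁ × H₂, (β p p).im = 0) ∧
    (∀ p : H₁ × H₂, p ≠ 0 → 0 < (β p p).re) ∧
    ∃ m M' : ℝ, 0 < m ∧ m ≤ M' ∧ ∀ p : H₁ × H₂,
      m * (‖p.1‖ ^ 2 + ‖p.2‖ ^ 2) ≤ (β p p).re ∧
      (β p p).re ≤ M' * (‖p.1‖ ^ 2 + ‖p.2‖ ^ 2) := by
  have key : ∀ p : H₁ × H₂, (β p p).re = ‖p.2 + B p.1‖ ^ 2 - ‖B p.1‖ ^ 2 + (⟪p.1, M p.1⟫).re := by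
    intro p
    have h1 := norm_add_sq (𝕜 := ℂ) p.2 (B p.1)
    have h2 : (⟪B p.1, p.2⟫).re = (⟪p.2, B p.1⟫).re := by
      rw [← inner_conj_symm (B p.1) p.2, Complex.conj_re]
    have h3 : (⟪p.2, p.2⟫).re = ‖p.2‖ ^ 2 := inner_self_eq_norm_sq (𝕜 := ℂ) p.2
    have h4 : RCLike.re (⟪p.2, B p.1⟫) = (⟪p.2, B p.1⟫).re := rfl
    rw [h4] at h1
    rw [hβ]
    simp only [Complex.add_re]
    rw [h1, h2, h3]
    ring
  have hK0 : 0 ≤ ‖B‖ ^ 2 := by positivity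
  have hD : 0 < 2 * c + 1 + 2 * ‖B‖ ^ 2 := by positivity
  set m : ℝ := c / (2 * c + 1 + 2 * ‖B‖ ^ 2) with hm
  have hm0 : 0 < m := by positivity
  have hmD : m * (2 * c + 1 + 2 * ‖B‖ ^ 2) = c := by rw [hm]; field_simp
  have hm1 : m ≤ 1 / 2 := by
    rw [hm, div_le_iff₀ hD]; nlinarith
  have hm2 : m * (1 + 2 * ‖B‖ ^ 2) ≤ c := by nlinarith [mul_pos hm0 hc]
  have hB : ∀ u, ‖B u‖ ^ 2 ≤ ‖B‖ ^ 2 * ‖u‖ ^ 2 := by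
    intro u
    rw [← mul_pow]
    exact pow_le_pow_left₀ (norm_nonneg _) (B.le_opNorm u) 2
  have low : ∀ p : H₁ × H₂, m * (‖p.1‖ ^ 2 + ‖p.2‖ ^ 2) ≤ (β p p).re := by
    intro p
    rw [key]
    have h1 := hcoerc p.1
    have h2 : ‖p.2‖ ≤ ‖p.2 + B p.1‖ + ‖B p.1‖ := by
      simpa using norm_sub_le (p.2 + B p.1) (B p.1)
    have h3 : ‖p.2‖ ^ 2 ≤ 2 * ‖p.2 + B p.1‖ ^ 2 + 2 * ‖B p.1‖ ^ 2 := by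
      have := pow_le_pow_left₀ (norm_nonneg _) h2 2
      nlinarith [sq_nonneg (‖p.2 + B p.1‖ - ‖B p.1‖)]
    have h4 := hB p.1
    have h5 : m * (‖p.1‖ ^ 2 + ‖p.2‖ ^ 2) ≤
        m * (‖p.1‖ ^ 2 + (2 * ‖p.2 + B p.1‖ ^ 2 + 2 * (‖B‖ ^ 2 * ‖p.1‖ ^ 2))) :=
      mul_le_mul_of_nonneg_left (by linarith) hm0.le
    have h6 := mul_le_mul_of_nonneg_right hm2 (sq_nonneg ‖p.1‖)
    have h7 := mul_le_mul_of_nonneg_right hm1 (sq_nonneg ‖p.2 + B p.1‖)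
    linarith
  refine ⟨?_, ?_, m, 2 + 2 * ‖B‖ ^ 2 + ‖M‖, hm0, ?_, fun p => ⟨low p, ?_⟩⟩
  · intro p
    have h2 : (⟪B p.1, p.2⟫).im = -(⟪p.2, B p.1⟫).im := by
      rw [← inner_conj_symm (B p.1) p.2, Complex.conj_im]
    have h3 : (⟪p.2, p.2⟫).im = 0 := inner_self_im (𝕜 := ℂ) p.2
    have h4 : (⟪p.1, M p.1⟫).im = 0 := by
      have h5 : ⟪M p.1, p.1⟫ = ⟪p.1, M p.1⟫ := hM.isSymmetric p.1 p.1
      rw [← inner_conj_symm (M p.1) p.1] at h5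
      exact Complex.conj_eq_iff_im.mp h5
    rw [hβ]
    simp only [Complex.add_im]
    rw [h2, h3, h4]
    ring
  · intro p hp
    refine lt_of_lt_of_le (mul_pos hm0 ?_) (low p)
    by_cases h : p.1 = 0
    · have h' : p.2 ≠ 0 := fun h2 => hp (Prod.ext h h2)
      have := norm_pos_iff.mpr h'
      positivity
    · have := norm_pos_iff.mpr h
      positivity
  · linarith [norm_nonneg M]
  · rw [key]
    have h1 : (⟪p.1, M p.1⟫).re ≤ ‖M‖ * ‖p.1‖ ^ 2 := by
      have a := Complex.re_le_norm (⟪p.1, M p.1⟫)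
      have b := norm_inner_le_norm (𝕜 := ℂ) p.1 (M p.1)
      have d := mul_le_mul_of_nonneg_left (M.le_opNorm p.1) (norm_nonneg p.1)
      nlinarith
    have h3 : ‖p.2 + B p.1‖ ^ 2 ≤ 2 * ‖p.2‖ ^ 2 + 2 * ‖B p.1‖ ^ 2 := by
      have := pow_le_pow_left₀ (norm_nonneg _) (norm_add_le p.2 (B p.1)) 2
      nlinarith [sq_nonneg (‖p.2‖ - ‖B p.1‖)]
    have h4 := hB p.1
    have h5 : 0 ≤ (2 * ‖B‖ ^ 2 + ‖M‖) * ‖p.2‖ ^ 2 := by positivity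
    nlinarith [sq_nonneg ‖p.1‖, sq_nonneg ‖B p.1‖]
end
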